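/- Under the projective transformation Ψ with q1 = x + (b̄21 − ā30) z − ā21 w, q2 = y − b̄30 z, q3 = z, q4 = w, p = 1 + (−ā30 + 2b̄21)x − ā21 y + (−ā21 b̄30 − ā30 b̄21 + b̄31) z + (−ā21 b̄21 + b̄22) w, the 4-jet of the Monge form (x² + ā30 x³ + ā21 x² y + ā40 x⁴ + ā31 x³ y, xy + b̄30 x³ + b̄21 x² y + b̄40 x⁴ + b̄31 x³ y + b̄22 x² y²) is transformed to (x² + Γ40 x⁴ + Γ31 x³ y, xy + Θ40 x⁴) with Γ31 = ā31 − ā21 ā30 − ā21 b̄21 − b̄22, Γ40 = ā40 − ā30² + b̄21² − b̄31, and Θ40 = b̄40 − ā30 b̄30 − b̄21 b̄30. -/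

import Mathlib

open Asymptotics

/-- `f` is, up to `O(‖v‖⁵)`, the sum of the functions `c₀, …, c₄`, where `cᵢ = O(‖v‖ⁱ)`. -/
structure HasFourJet (f c₀ c₁ c₂ c₃ c₄ : ℝ × ℝ → ℝ) : Prop where
  bound₀ : c₀ =O[nhds 0] fun v : ℝ × ℝ => ‖v‖ ^ 0
  bound₁ : c₁ =O[nhds 0] fun v : ℝ × ℝ => ‖v‖ ^ 1
  bound₂ : c₂ =O[nhds 0] fun v : ℝ × ℝ => ‖v‖ ^ 2
  bound₃ : c₃ =O[nhds 0] fun v : ℝ × ℝ => ‖v‖ ^ 3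
  bound₄ : c₄ =O[nhds 0] fun v : ℝ × ℝ => ‖v‖ ^ 4
  remainder : (fun v => f v - (c₀ v + c₁ v + c₂ v + c₃ v + c₄ v)) =O[nhds 0]
    fun v : ℝ × ℝ => ‖v‖ ^ 5

theorem isBigO_norm_pow_of_le {m n : ℕ} (h : m ≤ n) :
    (fun v : ℝ × ℝ => ‖v‖ ^ n) =O[nhds 0] fun v : ℝ × ℝ => ‖v‖ ^ m := by
  refine IsBigO.of_bound 1 ?_
  filter_upwards [Metric.ball_mem_nhds (0 : ℝ × ℝ) one_pos] with v hv
  rw [mem_ball_zero_iff] at hv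
  simpa using pow_le_pow_of_le_one (norm_nonneg v) hv.le h

theorem isBigO_norm_pow_mul {f g : ℝ × ℝ → ℝ} {m n k : ℕ}
    (hf : f =O[nhds 0] fun v : ℝ × ℝ => ‖v‖ ^ m)
    (hg : g =O[nhds 0] fun v : ℝ × ℝ => ‖v‖ ^ n) (h : k ≤ m + n) :
    (fun v => f v * g v) =O[nhds 0] fun v : ℝ × ℝ => ‖v‖ ^ k := by
  refine IsBigO.trans ?_ (isBigO_norm_pow_of_le h)
  simpa only [pow_add] using hf.mul hg

theorem isBigO_monomial (a : ℝ) (i j : ℕ) :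
    (fun v : ℝ × ℝ => a * (v.1 ^ i * v.2 ^ j)) =O[nhds 0]
      fun v : ℝ × ℝ => ‖v‖ ^ (i + j) := by
  have hx : (fun v : ℝ × ℝ => v.1) =O[nhds 0] fun v : ℝ × ℝ => ‖v‖ :=
    isBigO_fst_prod'.norm_right
  have hy : (fun v : ℝ × ℝ => v.2) =O[nhds 0] fun v : ℝ × ℝ => ‖v‖ :=
    isBigO_snd_prod'.norm_right
  simpa only [pow_add] using ((hx.pow i).mul (hy.pow j)).const_mul_left a

namespace HasFourJet

variable {f g c₀ c₁ c₂ c₃ c₄ d₀ d₁ d₂ d₃ d₄ : ℝ × ℝ → ℝ}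

theorem isBigO_one (hf : HasFourJet f c₀ c₁ c₂ c₃ c₄) :
    f =O[nhds 0] fun v : ℝ × ℝ => ‖v‖ ^ 0 := by
  have h := ((((hf.bound₀.add (hf.bound₁.trans (isBigO_norm_pow_of_le (Nat.zero_le _)))).add
    (hf.bound₂.trans (isBigO_norm_pow_of_le (Nat.zero_le _)))).add
    (hf.bound₃.trans (isBigO_norm_pow_of_le (Nat.zero_le _)))).add
    (hf.bound₄.trans (isBigO_norm_pow_of_le (Nat.zero_le _)))).add
    (hf.remainder.trans (isBigO_norm_pow_of_le (Nat.zero_le _)))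
  exact h.congr_left fun v => by ring

theorem add (hf : HasFourJet f c₀ c₁ c₂ c₃ c₄) (hg : HasFourJet g d₀ d₁ d₂ d₃ d₄) :
    HasFourJet (fun v => f v + g v) (fun v => c₀ v + d₀ v) (fun v => c₁ v + d₁ v)
      (fun v => c₂ v + d₂ v) (fun v => c₃ v + d₃ v) (fun v => c₄ v + d₄ v) where
  bound₀ := hf.bound₀.add hg.bound₀
  bound₁ := hf.bound₁.add hg.bound₁
  bound₂ := hf.bound₂.add hg.bound₂
  bound₃ := hf.bound₃.add hg.bound₃
  bound₄ := hf.bound₄.add hg.bound₄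
  remainder := (hf.remainder.add hg.remainder).congr_left fun v => by ring

theorem const_mul (a : ℝ) (hf : HasFourJet f c₀ c₁ c₂ c₃ c₄) :
    HasFourJet (fun v => a * f v) (fun v => a * c₀ v) (fun v => a * c₁ v)
      (fun v => a * c₂ v) (fun v => a * c₃ v) (fun v => a * c₄ v) where
  bound₀ := hf.bound₀.const_mul_left a
  bound₁ := hf.bound₁.const_mul_left a
  bound₂ := hf.bound₂.const_mul_left a
  bound₃ := hf.bound₃.const_mul_left a
  bound₄ := hf.bound₄.const_mul_left a
  remainder := (hf.remainder.const_mul_left a).congr_left fun v => by ring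

theorem sub (hf : HasFourJet f c₀ c₁ c₂ c₃ c₄) (hg : HasFourJet g d₀ d₁ d₂ d₃ d₄) :
    HasFourJet (fun v => f v - g v) (fun v => c₀ v - d₀ v) (fun v => c₁ v - d₁ v)
      (fun v => c₂ v - d₂ v) (fun v => c₃ v - d₃ v) (fun v => c₄ v - d₄ v) where
  bound₀ := hf.bound₀.sub hg.bound₀
  bound₁ := hf.bound₁.sub hg.bound₁
  bound₂ := hf.bound₂.sub hg.bound₂
  bound₃ := hf.bound₃.sub hg.bound₃
  bound₄ := hf.bound₄.sub hg.bound₄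
  remainder := (hf.remainder.sub hg.remainder).congr_left fun v => by ring

theorem mul (hf : HasFourJet f c₀ c₁ c₂ c₃ c₄) (hg : HasFourJet g d₀ d₁ d₂ d₃ d₄) :
    HasFourJet (fun v => f v * g v) (fun v => c₀ v * d₀ v)
      (fun v => c₀ v * d₁ v + c₁ v * d₀ v)
      (fun v => c₀ v * d₂ v + c₁ v * d₁ v + c₂ v * d₀ v)
      (fun v => c₀ v * d₃ v + c₁ v * d₂ v + c₂ v * d₁ v + c₃ v * d₀ v)
      (fun v => c₀ v * d₄ v + c₁ v * d₃ v + c₂ v * d₂ v + c₃ v * d₁ v + c₄ v * d₀ v) where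
  bound₀ := isBigO_norm_pow_mul hf.bound₀ hg.bound₀ le_rfl
  bound₁ := (isBigO_norm_pow_mul hf.bound₀ hg.bound₁ le_rfl).add
    (isBigO_norm_pow_mul hf.bound₁ hg.bound₀ le_rfl)
  bound₂ := ((isBigO_norm_pow_mul hf.bound₀ hg.bound₂ le_rfl).add
    (isBigO_norm_pow_mul hf.bound₁ hg.bound₁ le_rfl)).add
    (isBigO_norm_pow_mul hf.bound₂ hg.bound₀ le_rfl)
  bound₃ := (((isBigO_norm_pow_mul hf.bound₀ hg.bound₃ le_rfl).add
    (isBigO_norm_pow_mul hf.bound₁ hg.bound₂ le_rfl)).add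
    (isBigO_norm_pow_mul hf.bound₂ hg.bound₁ le_rfl)).add
    (isBigO_norm_pow_mul hf.bound₃ hg.bound₀ le_rfl)
  bound₄ := ((((isBigO_norm_pow_mul hf.bound₀ hg.bound₄ le_rfl).add
    (isBigO_norm_pow_mul hf.bound₁ hg.bound₃ le_rfl)).add
    (isBigO_norm_pow_mul hf.bound₂ hg.bound₂ le_rfl)).add
    (isBigO_norm_pow_mul hf.bound₃ hg.bound₁ le_rfl)).add
    (isBigO_norm_pow_mul hf.bound₄ hg.bound₀ le_rfl)
  remainder := by
    have hfg := isBigO_norm_pow_mul (k := 5) hf.remainder hg.isBigO_one (by norm_num)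
    have hC := isBigO_norm_pow_mul (k := 5)
      (hf.isBigO_one.sub (hf.remainder.trans (isBigO_norm_pow_of_le (Nat.zero_le _))))
      hg.remainder (by norm_num)
    have h₁₄ := isBigO_norm_pow_mul (k := 5) hf.bound₁ hg.bound₄ (by norm_num)
    have h₂₃ := isBigO_norm_pow_mul (k := 5) hf.bound₂ hg.bound₃ (by norm_num)
    have h₂₄ := isBigO_norm_pow_mul (k := 5) hf.bound₂ hg.bound₄ (by norm_num)
    have h₃₂ := isBigO_norm_pow_mul (k := 5) hf.bound₃ hg.bound₂ (by norm_num)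
    have h₃₃ := isBigO_norm_pow_mul (k := 5) hf.bound₃ hg.bound₃ (by norm_num)
    have h₃₄ := isBigO_norm_pow_mul (k := 5) hf.bound₃ hg.bound₄ (by norm_num)
    have h₄₁ := isBigO_norm_pow_mul (k := 5) hf.bound₄ hg.bound₁ (by norm_num)
    have h₄₂ := isBigO_norm_pow_mul (k := 5) hf.bound₄ hg.bound₂ (by norm_num)
    have h₄₃ := isBigO_norm_pow_mul (k := 5) hf.bound₄ hg.bound₃ (by norm_num)
    have h₄₄ := isBigO_norm_pow_mul (k := 5) hf.bound₄ hg.bound₄ (by norm_num)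
    exact (((((((((((hfg.add hC).add h₁₄).add h₂₃).add h₂₄).add h₃₂
      ).add h₃₃).add h₃₄).add h₄₁).add h₄₂
      ).add h₄₃).add h₄₄).congr_left fun v => by ring

theorem isBigO_of_sum_eq_zero (hf : HasFourJet f c₀ c₁ c₂ c₃ c₄)
    (h : ∀ v, c₀ v + c₁ v + c₂ v + c₃ v + c₄ v = 0) :
    f =O[nhds 0] fun v : ℝ × ℝ => ‖v‖ ^ 5 :=
  hf.remainder.congr_left fun v => by rw [h v, sub_zero]

end HasFourJet

/-- Clearing a denominator that does not vanish at the origin. -/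
theorem isLittleO_of_mul_pow_isBigO {D P : ℝ × ℝ → ℝ} {k : ℕ} (hP : ContinuousAt P 0)
    (hP₀ : P 0 ≠ 0) (h : (fun v => D v * P v ^ k) =O[nhds 0] fun v : ℝ × ℝ => ‖v‖ ^ 5) :
    D =o[nhds 0] fun v : ℝ × ℝ => ‖v‖ ^ 4 := by
  have hinv : (fun v => (P v ^ k)⁻¹) =O[nhds 0] fun _ : ℝ × ℝ => (1 : ℝ) :=
    ((hP.pow k).inv₀ (pow_ne_zero k hP₀)).isBigO_one ℝ
  have hD : D =O[nhds 0] fun v : ℝ × ℝ => ‖v‖ ^ 5 := by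
    refine (h.mul hinv).congr' ?_ (by simp)
    filter_upwards [hP.eventually_ne hP₀] with v hv
    field_simp
  refine hD.trans_isLittleO ?_
  exact (isLittleO_pow_pow (𝕜 := ℝ) (by norm_num : 4 < 5)).comp_tendsto tendsto_norm_zero

/-- Projective normalization of the 4-jet of a ruled surface at a
parabolic point. Under `Ψ` with `q1 = x + (b̄21 − ā30) z − ā21 w`,
`q2 = y − b̄30 z`, `q3 = z`, `q4 = w`,
`p = 1 + (−ā30 + 2b̄21)x − ā21 y + (−ā21 b̄30 − ā30 b̄21 + b̄31) z +
(−ā21 b̄21 + b̄22) w`, the 4-jet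
`(x² + ā30 x³ + ā21 x²y + ā40 x⁴ + ā31 x³y,
  xy + b̄30 x³ + b̄21 x²y + b̄40 x⁴ + b̄31 x³y + b̄22 x²y²)`
is transformed to `(x² + Γ40 x⁴ + Γ31 x³y, xy + Θ40 x⁴)` with
`Γ31 = ā31 − ā21 ā30 − ā21 b̄21 − b̄22`, `Γ40 = ā40 − ā30² + b̄21² − b̄31`,
`Θ40 = b̄40 − ā30 b̄30 − b̄21 b̄30`: the transformed graph equations hold up to
order `o(‖(x,y)‖⁴)`. -/
theorem four_jet_projective_normal_form
    (a30 a21 a40 a31 b30 b21 b40 b31 b22 : ℝ) :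
    let f1 : ℝ → ℝ → ℝ := fun x y =>
      x ^ 2 + a30 * x ^ 3 + a21 * x ^ 2 * y + a40 * x ^ 4 + a31 * x ^ 3 * y
    let f2 : ℝ → ℝ → ℝ := fun x y =>
      x * y + b30 * x ^ 3 + b21 * x ^ 2 * y + b40 * x ^ 4 + b31 * x ^ 3 * y +
        b22 * x ^ 2 * y ^ 2
    let Γ31 : ℝ := a31 - a21 * a30 - a21 * b21 - b22
    let Γ40 : ℝ := a40 - a30 ^ 2 + b21 ^ 2 - b31
    let Θ40 : ℝ := b40 - a30 * b30 - b21 * b30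
    let g1 : ℝ → ℝ → ℝ := fun x y => x ^ 2 + Γ40 * x ^ 4 + Γ31 * x ^ 3 * y
    let g2 : ℝ → ℝ → ℝ := fun x y => x * y + Θ40 * x ^ 4
    let P : ℝ × ℝ → ℝ := fun v =>
      1 + (-a30 + 2 * b21) * v.1 - a21 * v.2 +
        (-a21 * b30 - a30 * b21 + b31) * g1 v.1 v.2 +
        (-a21 * b21 + b22) * g2 v.1 v.2
    let Q1 : ℝ × ℝ → ℝ := fun v =>
      v.1 + (b21 - a30) * g1 v.1 v.2 - a21 * g2 v.1 v.2
    let Q2 : ℝ × ℝ → ℝ := fun v => v.2 - b30 * g1 v.1 v.2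
    let Q3 : ℝ × ℝ → ℝ := fun v => g1 v.1 v.2
    let Q4 : ℝ × ℝ → ℝ := fun v => g2 v.1 v.2
    ((fun v : ℝ × ℝ => Q3 v / P v - f1 (Q1 v / P v) (Q2 v / P v)) =o[nhds 0]
        fun v : ℝ × ℝ => ‖v‖ ^ 4) ∧
    ((fun v : ℝ × ℝ => Q4 v / P v - f2 (Q1 v / P v) (Q2 v / P v)) =o[nhds 0]
        fun v : ℝ × ℝ => ‖v‖ ^ 4) := by
  intro f1 f2 Γ31 Γ40 Θ40 g1 g2 P Q1 Q2 Q3 Q4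
  have hone : (fun _ : ℝ × ℝ => (1 : ℝ)) =O[nhds 0] fun v : ℝ × ℝ => ‖v‖ ^ 0 :=
    (isBigO_monomial 1 0 0).congr_left fun v => by ring
  have hx : HasFourJet (fun v => v.1) 0 (fun v => v.1) 0 0 0 :=
    ⟨isBigO_zero _ _, (isBigO_monomial 1 1 0).congr_left fun v => by ring, isBigO_zero _ _,
      isBigO_zero _ _, isBigO_zero _ _, (isBigO_zero _ _).congr_left fun v => by simp⟩
  have hy : HasFourJet (fun v => v.2) 0 (fun v => v.2) 0 0 0 :=
    ⟨isBigO_zero _ _, (isBigO_monomial 1 0 1).congr_left fun v => by ring, isBigO_zero _ _,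
      isBigO_zero _ _, isBigO_zero _ _, (isBigO_zero _ _).congr_left fun v => by simp⟩
  have h1 : HasFourJet (fun _ => 1) (fun _ => 1) 0 0 0 0 :=
    ⟨hone, isBigO_zero _ _, isBigO_zero _ _,
      isBigO_zero _ _, isBigO_zero _ _, (isBigO_zero _ _).congr_left fun v => by simp⟩
  have hQ3 : HasFourJet Q3 0 0 (fun v => v.1 ^ 2) 0
      (fun v => Γ40 * v.1 ^ 4 + Γ31 * v.1 ^ 3 * v.2) :=
    ⟨isBigO_zero _ _, isBigO_zero _ _, (isBigO_monomial 1 2 0).congr_left fun v => by ring,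
      isBigO_zero _ _,
      ((isBigO_monomial Γ40 4 0).add (isBigO_monomial Γ31 3 1)).congr_left fun v => by ring,
      (isBigO_zero _ _).congr_left fun v => by simp only [Q3, g1, Pi.zero_apply]; ring⟩
  have hQ4 : HasFourJet Q4 0 0 (fun v => v.1 * v.2) 0 (fun v => Θ40 * v.1 ^ 4) :=
    ⟨isBigO_zero _ _, isBigO_zero _ _, (isBigO_monomial 1 1 1).congr_left fun v => by ring,
      isBigO_zero _ _, (isBigO_monomial Θ40 4 0).congr_left fun v => by ring,
      (isBigO_zero _ _).congr_left fun v => by simp only [Q4, g2, Pi.zero_apply]; ring⟩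
  have hQ1 := (hx.add (hQ3.const_mul (b21 - a30))).sub (hQ4.const_mul a21)
  have hQ2 := hy.sub (hQ3.const_mul b30)
  have hP := (((h1.add (hx.const_mul (-a30 + 2 * b21))).sub (hy.const_mul a21)).add
    (hQ3.const_mul (-a21 * b30 - a30 * b21 + b31))).add (hQ4.const_mul (-a21 * b21 + b22))
  change HasFourJet Q1 _ _ _ _ _ at hQ1
  change HasFourJet Q2 _ _ _ _ _ at hQ2
  change HasFourJet P _ _ _ _ _ at hP
  have hPc : ContinuousAt P 0 := by
    simp only [P, g1, g2]
    fun_prop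
  have hP₀ : P 0 ≠ 0 := by simp [P, g1, g2]
  have hPne := hPc.eventually_ne hP₀
  have hP2 := hP.mul hP
  have hP3 := hP2.mul hP
  have hQ11 := hQ1.mul hQ1
  have hQ12 := hQ1.mul hQ2
  have hQ111 := hQ11.mul hQ1
  have hQ112 := hQ11.mul hQ2
  constructor
  · have hE := (((((hQ3.mul hP3).sub (hQ11.mul hP2)).sub ((hQ111.mul hP).const_mul a30)).sub
      ((hQ112.mul hP).const_mul a21)).sub ((hQ11.mul hQ11).const_mul a40)).sub
      ((hQ11.mul hQ12).const_mul a31)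
    refine isLittleO_of_mul_pow_isBigO (k := 4) hPc hP₀
      ((hE.isBigO_of_sum_eq_zero fun v => ?_).congr' ?_ .rfl)
    · simp only [Pi.zero_apply, Γ31, Γ40, Θ40]
      ring
    · filter_upwards [hPne] with v hv
      simp only [f1]
      generalize P v = p, Q1 v = q1, Q2 v = q2, Q3 v = q3 at hv ⊢
      clear * - hv
      field_simp
      ring
  · have hE := ((((((hQ4.mul hP3).sub (hQ12.mul hP2)).sub ((hQ111.mul hP).const_mul b30)).sub
      ((hQ112.mul hP).const_mul b21)).sub ((hQ11.mul hQ11).const_mul b40)).sub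
      ((hQ11.mul hQ12).const_mul b31)).sub ((hQ12.mul hQ12).const_mul b22)
    refine isLittleO_of_mul_pow_isBigO (k := 4) hPc hP₀
      ((hE.isBigO_of_sum_eq_zero fun v => ?_).congr' ?_ .rfl)
    · simp only [Pi.zero_apply, Γ31, Γ40, Θ40]
      ring
    · filter_upwards [hPne] with v hv
      simp only [f2]
      generalize P v = p, Q1 v = q1, Q2 v = q2, Q4 v = q4 at hv ⊢
      clear * - hv
      field_simp
      ring
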